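/- Let F be an algebraically closed field of characteristic different from 2 and 3, fix a primitive cube root of unity ω ∈ F, let S = {[v] ∈ ℙ³(F) : v₀³ + v₁³ + v₂³ + v₃³ = 0} be the Fermat cubic surface, and let Aut(S) be the subgroup of PGL₄(F) = GL₄(F)/F^× of elements mapping S onto itself. Then for every element s ∈ Aut(S) of type A₂, the centralizer of s in Aut(S) is isomorphic to a semidirect product (ℤ/3ℤ)³ ⋊ (ℤ/2ℤ)² (for a suitable action of (ℤ/2ℤ)² on (ℤ/3ℤ)³); in particular this centralizer has order 108. -/

import Mathlib

open Polynomial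

/-- The subgroup of nonzero scalar matrices in `GL₄(F)`; the quotient by it is `PGL₄(F)`. -/
def scalarUnits (F : Type*) [Field F] : Subgroup (Matrix (Fin 4) (Fin 4) F)ˣ where
  carrier := {g | ∃ c : F, (g : Matrix (Fin 4) (Fin 4) F) = c • (1 : Matrix (Fin 4) (Fin 4) F)}
  one_mem' := ⟨1, by simp⟩
  mul_mem' := by
    rintro a b ⟨c, hc⟩ ⟨d, hd⟩
    exact ⟨c * d, by rw [Units.val_mul, hc, hd, smul_mul_smul_comm, one_mul]⟩
  inv_mem' := by
    rintro a ⟨c, hc⟩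
    have hc0 : c ≠ 0 := by
      rintro rfl
      have h1 : ((a : Matrix (Fin 4) (Fin 4) F)) * ((a⁻¹ : (Matrix (Fin 4) (Fin 4) F)ˣ) :
          Matrix (Fin 4) (Fin 4) F) = 1 := Units.mul_inv _
      rw [hc] at h1
      simp at h1
    refine ⟨c⁻¹, Units.inv_eq_of_mul_eq_one_right ?_⟩
    rw [hc, smul_mul_smul_comm, one_mul, mul_inv_cancel₀ hc0, one_smul]

instance scalarUnits_normal (F : Type*) [Field F] : (scalarUnits F).Normal := by
  constructor
  rintro n ⟨c, hc⟩ g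
  refine ⟨c, ?_⟩
  rw [Units.val_mul, Units.val_mul, hc, mul_smul_comm, mul_one, smul_mul_assoc,
    Units.mul_inv]

/-- The projective general linear group `PGL₄(F) = GL₄(F)/F^×`. -/
abbrev PGL4 (F : Type*) [Field F] := (Matrix (Fin 4) (Fin 4) F)ˣ ⧸ scalarUnits F

/-- The affine cone over the Fermat cubic surface `S ⊂ ℙ³(F)`. -/
def fermatCone (F : Type*) [Field F] : Set (Fin 4 → F) :=
  {v | v 0 ^ 3 + v 1 ^ 3 + v 2 ^ 3 + v 3 ^ 3 = 0}

/-- A matrix `g ∈ GL₄(F)` induces an automorphism of the Fermat cubic surface iff it maps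
the affine cone over it onto itself. -/
def PreservesFermat {F : Type*} [Field F] (g : (Matrix (Fin 4) (Fin 4) F)ˣ) : Prop :=
  (Matrix.mulVecLin (g : Matrix (Fin 4) (Fin 4) F)) '' fermatCone F = fermatCone F

/-- The automorphism group `Aut(S) ⊆ PGL₄(F)` of the Fermat cubic surface `S`. -/
def autFermat (F : Type*) [Field F] : Subgroup (PGL4 F) where
  carrier := {x | ∃ g, QuotientGroup.mk g = x ∧ PreservesFermat g}
  one_mem' := by
    refine ⟨1, rfl, ?_⟩
    simp [PreservesFermat]
  mul_mem' := by
    rintro x y ⟨g, rfl, hg⟩ ⟨h, rfl, hh⟩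
    refine ⟨g * h, rfl, ?_⟩
    unfold PreservesFermat at *
    rw [Units.val_mul, Matrix.mulVecLin_mul, LinearMap.coe_comp, Set.image_comp, hh, hg]
  inv_mem' := by
    rintro x ⟨g, rfl, hg⟩
    refine ⟨g⁻¹, rfl, ?_⟩
    unfold PreservesFermat at *
    conv_lhs => rw [← hg, ← Set.image_comp, ← LinearMap.coe_comp, ← Matrix.mulVecLin_mul,
      ← Units.val_mul, inv_mul_cancel]
    simp

/-- An element of `PGL₄(F)` is of type `A₂` if some lift in `GL₄(F)` has characteristic
polynomial `(X−1)²(X−ω)²` or `(X−1)²(X−ω²)²`, i.e. eigenvalues `1, 1, ω, ω` up to a common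
scalar. -/
def TypeA2 {F : Type*} [Field F] (ω : F) (x : PGL4 F) : Prop :=
  ∃ g : (Matrix (Fin 4) (Fin 4) F)ˣ, QuotientGroup.mk g = x ∧
    ((g : Matrix (Fin 4) (Fin 4) F).charpoly = (X - 1) ^ 2 * (X - C ω) ^ 2 ∨
      (g : Matrix (Fin 4) (Fin 4) F).charpoly = (X - 1) ^ 2 * (X - C (ω ^ 2)) ^ 2)

section helpers
variable {F : Type*} [Field F]

/-- Monomial matrices whose nonzero entries all have the same nonzero cube. -/
def IsMon (g : Matrix (Fin 4) (Fin 4) F) (σ : Equiv.Perm (Fin 4)) (a : Fin 4 → F) (k : F) : Prop :=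
  k ≠ 0 ∧ (∀ i, a i ^ 3 = k) ∧ ∀ i j, g i j = if σ i = j then a i else 0

lemma IsMon.mulVec {g : Matrix (Fin 4) (Fin 4) F} {σ a k} (h : IsMon g σ a k) (v : Fin 4 → F)
    (i : Fin 4) : g.mulVec v i = a i * v (σ i) := by
  simp [Matrix.mulVec, dotProduct, h.2.2]

lemma mem_cone_iff (v : Fin 4 → F) : v ∈ fermatCone F ↔ ∑ i, v i ^ 3 = 0 := by
  simp [fermatCone, Fin.sum_univ_four]

lemma IsMon.mem_cone {g : Matrix (Fin 4) (Fin 4) F} {σ a k} (h : IsMon g σ a k) (v : Fin 4 → F)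
    (hv : v ∈ fermatCone F) : g.mulVec v ∈ fermatCone F := by
  rw [mem_cone_iff] at *
  simp only [h.mulVec, mul_pow, h.2.1, ← Finset.mul_sum]
  rw [Equiv.sum_comp σ (fun i => v i ^ 3), hv, mul_zero]

lemma preserves_of_le (g : (Matrix (Fin 4) (Fin 4) F)ˣ)
    (h1 : ∀ v ∈ fermatCone F, (g : Matrix (Fin 4) (Fin 4) F).mulVec v ∈ fermatCone F)
    (h2 : ∀ v ∈ fermatCone F, ((g⁻¹ : (Matrix (Fin 4) (Fin 4) F)ˣ) :
      Matrix (Fin 4) (Fin 4) F).mulVec v ∈ fermatCone F) : PreservesFermat g := by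
  apply Set.Subset.antisymm
  · rintro _ ⟨v, hv, rfl⟩
    exact h1 v hv
  · intro v hv
    refine ⟨_, h2 v hv, ?_⟩
    rw [Matrix.mulVecLin_apply, Matrix.mulVec_mulVec, Units.mul_inv, Matrix.one_mulVec]

/-- The trilinear coefficients. -/
lemma row_disjoint [IsAlgClosed F]
    (hchar2 : (2 : F) ≠ 0) (hchar3 : (3 : F) ≠ 0)
    (ω : F) (hω3 : ω ^ 3 = 1) (hω : ω ≠ 1) (g : (Matrix (Fin 4) (Fin 4) F)ˣ)
    (h1 : ∀ v ∈ fermatCone F, (g : Matrix (Fin 4) (Fin 4) F).mulVec v ∈ fermatCone F) :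
    ∃ k, ∀ a b c, ∑ i, g.val i a * g.val i b * g.val i c = if a = b ∧ b = c then k else 0 := by
  have hs : 1 + ω + ω ^ 2 = 0 := by
    have : (ω - 1) * (1 + ω + ω ^ 2) = 0 := by linear_combination hω3
    rcases mul_eq_zero.1 this with h | h
    · exact absurd (sub_eq_zero.1 h) hω
    · exact h
  set B : Fin 4 → Fin 4 → Fin 4 → F := fun a b c => ∑ i, g.val i a * g.val i b * g.val i c with hB
  have key : ∀ (a b c : Fin 4) (x y z : F), a ≠ b → a ≠ c → b ≠ c → x ^ 3 + y ^ 3 + z ^ 3 = 0 →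
      B a a a * x ^ 3 + B b b b * y ^ 3 + B c c c * z ^ 3 + 3 * B a a b * x ^ 2 * y
      + 3 * B a a c * x ^ 2 * z + 3 * B b b a * y ^ 2 * x + 3 * B b b c * y ^ 2 * z
      + 3 * B c c a * z ^ 2 * x + 3 * B c c b * z ^ 2 * y + 6 * B a b c * x * y * z = 0 := by
    intro a b c x y z hab hac hbc h
    have := h1 (Pi.single a x + Pi.single b y + Pi.single c z) (by
      rw [mem_cone_iff]
      have e : ∀ i, (Pi.single a x + Pi.single b y + Pi.single c z : Fin 4 → F) i ^ 3
          = (Pi.single a (x ^ 3) + Pi.single b (y ^ 3) + Pi.single c (z ^ 3) : Fin 4 → F) i := by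
        intro i
        simp only [Pi.add_apply, Pi.single_apply]
        split_ifs <;> simp_all
      rw [Finset.sum_congr rfl (fun i _ => e i)]
      simpa [Finset.sum_add_distrib] using h)
    rw [mem_cone_iff] at this
    simp only [Matrix.mulVec_add, Matrix.mulVec_single, Pi.add_apply, Pi.smul_apply,
      Matrix.col_apply, Fin.sum_univ_four, MulOpposite.smul_eq_mul_unop,
      MulOpposite.unop_op] at this
    simp only [hB, Fin.sum_univ_four]
    linear_combination this
  have pair : ∀ a b : Fin 4, a ≠ b → B a a a = B b b b ∧ B a a b = 0 := by
    intro a b hab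
    obtain ⟨c, hac, hbc⟩ : ∃ c : Fin 4, a ≠ c ∧ b ≠ c := by
      revert a b; decide
    have e0 := key a b c 1 (-1) 0 hab hac hbc (by ring)
    have e1 := key a b c 1 (-ω) 0 hab hac hbc (by linear_combination -hω3)
    have e2 := key a b c 1 (-ω ^ 2) 0 hab hac hbc (by linear_combination (-ω^3-1) * hω3)
    have h3 : (3 : F) * (B a a a - B b b b) = 0 := by
      linear_combination e0 + e1 + e2 + (3 * B a a b - 3 * B b b a * (1 - ω + ω ^ 2)) * hs
        + (B b b b * (2 + ω ^ 3)) * hω3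
    have h9 : (3 * 3 : F) * B a a b = 0 := by
      linear_combination -e0 - ω^2 * e1 - ω * e2 + (B a a a + 3 * B b b a + 0) * hs
        + (-6 * B a a b + 3 * B b b a * (ω + ω ^ 2) - B b b b * (ω ^ 2 + ω * (ω ^ 3 + 1))) * hω3
        - B b b b * hs
    exact ⟨sub_eq_zero.1 ((mul_eq_zero.1 h3).resolve_left hchar3),
      (mul_eq_zero.1 h9).resolve_left (mul_ne_zero hchar3 hchar3)⟩
  have triple : ∀ a b c : Fin 4, a ≠ b → a ≠ c → b ≠ c → B a b c = 0 := by
    intro a b c hab hac hbc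
    obtain ⟨z, hz⟩ := IsAlgClosed.exists_pow_nat_eq (-2 : F) (n := 3) (by norm_num)
    have e := key a b c 1 1 z hab hac hbc (by rw [hz]; ring)
    rw [(pair a b hab).2, (pair a c hac).2, (pair b a hab.symm).2, (pair b c hbc).2,
      (pair c a hac.symm).2, (pair c b hbc.symm).2, (pair a b hab).1, (pair b c hbc).1] at e
    have hz0 : z ≠ 0 := by
      rintro rfl
      apply hchar2
      linear_combination hz
    have : (2 * 3 * z) * B a b c = 0 := by linear_combination e - B c c c * hz
    exact (mul_eq_zero.1 this).resolve_left (mul_ne_zero (mul_ne_zero hchar2 hchar3) hz0)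
  have sw1 : ∀ a b c, B a b c = B b a c := fun a b c =>
    Finset.sum_congr rfl fun i _ => by ring
  have sw2 : ∀ a b c, B a b c = B a c b := fun a b c =>
    Finset.sum_congr rfl fun i _ => by ring
  refine ⟨B 0 0 0, fun a b c => ?_⟩
  change B a b c = _
  by_cases hab : a = b
  · subst hab
    by_cases hac : a = c
    · subst hac
      rw [if_pos ⟨rfl, rfl⟩]
      by_cases h0 : a = 0
      · rw [h0]
      · exact (pair a 0 h0).1
    · rw [if_neg (by tauto), (pair a c hac).2]
  · rw [if_neg (by tauto)]
    by_cases hac : a = c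
    · subst hac
      rw [sw2, (pair a b hab).2]
    · by_cases hbc : b = c
      · subst hbc
        rw [sw1, sw2, (pair b a (Ne.symm hab)).2]
      · exact triple a b c hab hac hbc

lemma exists_isMon [IsAlgClosed F]
    (hchar2 : (2 : F) ≠ 0) (hchar3 : (3 : F) ≠ 0)
    (ω : F) (hω3 : ω ^ 3 = 1) (hω : ω ≠ 1) (g : (Matrix (Fin 4) (Fin 4) F)ˣ)
    (h1 : ∀ v ∈ fermatCone F, (g : Matrix (Fin 4) (Fin 4) F).mulVec v ∈ fermatCone F) :
    ∃ σ a k, IsMon g.val σ a k := by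
  obtain ⟨k, hk⟩ := row_disjoint hchar2 hchar3 ω hω3 hω g h1
  have hdis : ∀ i a b, a ≠ b → g.val i a * g.val i b = 0 := by
    intro i a b hab
    have : Matrix.vecMul (fun i => g.val i a * g.val i b) g.val = 0 := by
      funext c
      simp only [Matrix.vecMul, dotProduct, Pi.zero_apply]
      rw [hk, if_neg (by tauto)]
    have h2 := congrArg (fun w => Matrix.vecMul w g⁻¹.val) this
    simp only [Matrix.vecMul_vecMul, Units.mul_inv, Matrix.vecMul_one, Matrix.zero_vecMul] at h2
    exact congrFun h2 i
  have hne : ∀ i, ∃ j, g.val i j ≠ 0 := by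
    intro i
    by_contra! h
    have h2 : (g.val * g⁻¹.val) i i = 1 := by rw [Units.mul_inv]; simp
    simp [Matrix.mul_apply, h] at h2
  choose σ hσ using hne
  have hz : ∀ i j, σ i ≠ j → g.val i j = 0 := fun i j hij =>
    (mul_eq_zero.1 (hdis i _ _ hij)).resolve_left (hσ i)
  have hprod : ∀ i j, (g.val * g⁻¹.val) i j = g.val i (σ i) * g⁻¹.val (σ i) j := by
    intro i j
    rw [Matrix.mul_apply]
    apply Finset.sum_eq_single
    · intro b _ hb
      rw [hz i b (Ne.symm hb), zero_mul]
    · simp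
  have hinj : Function.Injective σ := by
    intro i j hij
    by_contra hne
    have h2 := hprod i j
    have h3 := hprod j j
    rw [Units.mul_inv, Matrix.one_apply_ne hne, hij] at h2
    rw [Units.mul_inv, Matrix.one_apply_eq] at h3
    have h4 : g⁻¹.val (σ j) j = 0 := by
      refine (mul_eq_zero.1 h2.symm).resolve_left ?_
      rw [← hij]; exact hσ i
    rw [h4, mul_zero] at h3
    exact one_ne_zero h3
  have hcube : ∀ i, g.val i (σ i) ^ 3 = k := by
    intro i
    have := hk (σ i) (σ i) (σ i)
    rw [if_pos ⟨rfl, rfl⟩, Finset.sum_eq_single i] at this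
    · rw [← this]; ring
    · intro b _ hb
      rw [hz b (σ i) (fun h => hb (hinj h))]; ring
    · simp
  refine ⟨Equiv.ofBijective σ (Finite.injective_iff_bijective.1 hinj), fun i => g.val i (σ i), k,
    ?_, hcube, ?_⟩
  · rw [← hcube 0]; exact pow_ne_zero _ (hσ 0)
  · intro i j
    simp only [Equiv.ofBijective_apply]
    split_ifs with h
    · rw [h]
    · exact hz i j h

lemma eigen_root (g : Matrix (Fin 4) (Fin 4) F) (ω μ : F)
    (hg : g.charpoly = (X - 1) ^ 2 * (X - C ω) ^ 2) (v : Fin 4 → F) (hv : v ≠ 0)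
    (h : g.mulVec v = μ • v) : μ = 1 ∨ μ = ω := by
  have h1 : g.charpoly.eval μ = 0 := by
    rw [Matrix.eval_charpoly]
    apply Matrix.exists_mulVec_eq_zero_iff.1
    refine ⟨v, hv, ?_⟩
    rw [Matrix.sub_mulVec, h]
    simp [← Matrix.smul_one_eq_diagonal, Matrix.smul_mulVec]
  rw [hg] at h1
  simp only [eval_mul, eval_pow, eval_sub, eval_X, eval_one, eval_C, mul_eq_zero,
    pow_eq_zero_iff, ne_eq, OfNat.ofNat_ne_zero, not_false_eq_true, sub_eq_zero] at h1
  exact h1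

lemma perm_cases : ∀ σ : Equiv.Perm (Fin 4), σ ≠ 1 →
    ∃ i j, i ≠ j ∧ σ j = i ∧ (σ i = j ∨ (∃ k, k ≠ i ∧ k ≠ j ∧ σ k = j ∧ σ i = k) ∨
      ∃ k l, k ≠ i ∧ k ≠ j ∧ l ≠ i ∧ l ≠ j ∧ l ≠ k ∧ σ k = j ∧ σ l = k ∧ σ i = l) := by
  decide

lemma IsMon.perm_eq_one [IsAlgClosed F] (hchar2 : (2 : F) ≠ 0)
    (ω : F) (hω3 : ω ^ 3 = 1) (hω : ω ≠ 1) {g : Matrix (Fin 4) (Fin 4) F} {σ a k}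
    (h : IsMon g σ a k) (hg : g.charpoly = (X - 1) ^ 2 * (X - C ω) ^ 2) : σ = 1 := by
  by_contra hσ
  have ha : ∀ i, a i ≠ 0 := by
    intro i hi
    apply h.1
    rw [← h.2.1 i, hi]; ring
  have hω0 : ω ≠ 0 := by rintro rfl; simp at hω3
  have hE : ∀ i j, σ j = i → g.mulVec (Pi.single i 1) = a j • Pi.single j 1 := by
    rintro _ j rfl
    funext l
    rw [h.mulVec]
    by_cases hl : l = j
    · subst hl; simp
    · simp [hl]
  have hneg : ∀ μ : F, μ ≠ 0 → (μ = 1 ∨ μ = ω) → (-μ = 1 ∨ -μ = ω) → False := by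
    have hc : ∀ x y : F, x ^ 3 = 1 → y ^ 3 = 1 → -x = y → False := by
      rintro x _ hx hy rfl
      apply hchar2
      linear_combination -hx - hy
    intro μ hμ h1 h2
    have h1' : μ ^ 3 = 1 := by rcases h1 with h1 | h1 <;> rw [h1] <;> simp [hω3]
    rcases h2 with h2 | h2
    · exact hc _ _ h1' (one_pow 3) h2
    · exact hc _ _ h1' hω3 h2
  have hω1 : ω ^ 2 ≠ 1 := by
    intro h'
    apply hω
    linear_combination hω3 - ω * h'
  have hω2 : ω ^ 2 ≠ ω := by
    intro h'
    apply hω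
    have : ω * (ω - 1) = 0 := by linear_combination h'
    exact sub_eq_zero.1 ((mul_eq_zero.1 this).resolve_left hω0)
  obtain ⟨i, j, hij, hji, hc | ⟨k, hki, hkj, hc1, hc2⟩ |
    ⟨k, l, hki, hkj, hli, hlj, hlk, hc1, hc2, hc3⟩⟩ := perm_cases σ hσ
  · have e1 := hE i j hji
    have e2 := hE j i hc
    obtain ⟨μ, hμ⟩ := IsAlgClosed.exists_pow_nat_eq (a i * a j) (n := 2) (by norm_num)
    have hμ0 : μ ≠ 0 := by
      rintro rfl; exact mul_ne_zero (ha i) (ha j) (by rw [← hμ]; ring)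
    have main : ∀ ν : F, ν ≠ 0 → ν ^ 2 = a i * a j → ν = 1 ∨ ν = ω := by
      intro ν hν0 hν
      refine eigen_root g ω ν hg (ν • Pi.single i 1 + a j • Pi.single j 1) ?_ ?_
      · intro h0
        have := congrFun h0 i
        simp [hij, hν0] at this
      · rw [Matrix.mulVec_add, Matrix.mulVec_smul, Matrix.mulVec_smul, e1, e2]
        match_scalars
        · ring
        · linear_combination -hν
    exact hneg μ hμ0 (main μ hμ0 hμ) (main (-μ) (neg_ne_zero.2 hμ0) (by rw [← hμ]; ring))
  · have e1 := hE i j hji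
    have e2 := hE j k hc1
    have e3 := hE k i hc2
    obtain ⟨μ, hμ⟩ := IsAlgClosed.exists_pow_nat_eq (a i * a j * a k) (n := 3) (by norm_num)
    have hμ0 : μ ≠ 0 := by
      rintro rfl; exact mul_ne_zero (mul_ne_zero (ha i) (ha j)) (ha k) (by rw [← hμ]; ring)
    have main : ∀ ν : F, ν ≠ 0 → ν ^ 3 = a i * a j * a k → ν = 1 ∨ ν = ω := by
      intro ν hν0 hν
      refine eigen_root g ω ν hg (ν ^ 2 • Pi.single i 1 + (ν * a j) • Pi.single j 1
        + (a j * a k) • Pi.single k 1) ?_ ?_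
      · intro h0
        have := congrFun h0 i
        simp [hij, hν0, hki.symm] at this
      · rw [Matrix.mulVec_add, Matrix.mulVec_add, Matrix.mulVec_smul, Matrix.mulVec_smul,
          Matrix.mulVec_smul, e1, e2, e3]
        match_scalars
        · ring
        · ring
        · linear_combination -hν
    have m1 := main μ hμ0 hμ
    have m2 := main (ω * μ) (mul_ne_zero hω0 hμ0) (by rw [← hμ]; linear_combination μ ^ 3 * hω3)
    have m3 := main (ω ^ 2 * μ) (mul_ne_zero (pow_ne_zero _ hω0) hμ0)
      (by rw [← hμ]; linear_combination μ ^ 3 * (ω ^ 3 + 1) * hω3)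
    rcases m1 with rfl | rfl
    · rw [mul_one] at m3
      exact m3.elim hω1 hω2
    · rcases m2 with m2 | m2
      · exact hω1 (by rw [← m2]; ring)
      · exact hω2 (by rw [pow_two]; exact m2)
  · have e1 := hE i j hji
    have e2 := hE j k hc1
    have e3 := hE k l hc2
    have e4 := hE l i hc3
    obtain ⟨μ, hμ⟩ := IsAlgClosed.exists_pow_nat_eq (a i * a j * a k * a l) (n := 4) (by norm_num)
    have hμ0 : μ ≠ 0 := by
      rintro rfl
      exact mul_ne_zero (mul_ne_zero (mul_ne_zero (ha i) (ha j)) (ha k)) (ha l)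
        (by rw [← hμ]; ring)
    have main : ∀ ν : F, ν ≠ 0 → ν ^ 4 = a i * a j * a k * a l → ν = 1 ∨ ν = ω := by
      intro ν hν0 hν
      refine eigen_root g ω ν hg (ν ^ 3 • Pi.single i 1 + (ν ^ 2 * a j) • Pi.single j 1
        + (ν * a j * a k) • Pi.single k 1 + (a j * a k * a l) • Pi.single l 1) ?_ ?_
      · intro h0
        have := congrFun h0 i
        simp [hij, hν0, hki.symm, hli.symm] at this
      · rw [Matrix.mulVec_add, Matrix.mulVec_add, Matrix.mulVec_add, Matrix.mulVec_smul,
          Matrix.mulVec_smul, Matrix.mulVec_smul, Matrix.mulVec_smul, e1, e2, e3, e4]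
        match_scalars
        · ring
        · ring
        · ring
        · linear_combination -hν
    exact hneg μ hμ0 (main μ hμ0 hμ) (main (-μ) (neg_ne_zero.2 hμ0) (by rw [← hμ]; ring))

lemma exists_reorder (ω : F) (hω : ω ≠ 1) (a : Fin 4 → F)
    (h : ∏ i, (X - C (a i)) = (X - 1) ^ 2 * (X - C ω) ^ 2) :
    ∃ τ : Equiv.Perm (Fin 4), ∀ i, a (τ i) = if i.val < 2 then 1 else ω := by
  classical
  have h1 : ∀ i, a i = 1 ∨ a i = ω := by
    intro i
    have h1 := congrArg (eval (a i)) h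
    rw [eval_prod, Finset.prod_eq_zero (Finset.mem_univ i) (by simp)] at h1
    simp only [eval_mul, eval_pow, eval_sub, eval_X, eval_one, eval_C, zero_eq_mul,
      pow_eq_zero_iff, ne_eq, OfNat.ofNat_ne_zero, not_false_eq_true, sub_eq_zero] at h1
    exact h1
  have h2 : (Finset.univ.val.map a).count 1 = 2 := by
    have h3 := congrArg roots h
    have h4 : (∏ i, (X - C (a i))) = ((Finset.univ.val.map a).map (fun x => X - C x)).prod := by
      rw [Multiset.map_map]; rfl
    rw [h4, roots_multiset_prod_X_sub_C, roots_mul, roots_pow, roots_pow, roots_X_sub_C,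
      ← C_1, roots_X_sub_C] at h3
    · rw [h3]
      simp [hω.symm]
    · exact mul_ne_zero (pow_ne_zero _ (by rw [← C_1]; exact X_sub_C_ne_zero _))
        (pow_ne_zero _ (X_sub_C_ne_zero _))
  have h3 : (Finset.univ.filter (fun i => decide (a i = 1) = true)).card = 2 := by
    rw [Multiset.count_map] at h2
    rw [← h2, Finset.card_def, Finset.filter_val]
    congr 1
    apply Multiset.filter_congr
    intro i _
    simp [eq_comm]
  have comb : ∀ p : Fin 4 → Bool, (Finset.univ.filter (fun i => p i = true)).card = 2 →
      ∃ τ : Equiv.Perm (Fin 4), ∀ i, p (τ i) = decide (i.val < 2) := by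
    decide
  obtain ⟨τ, hτ⟩ := comb _ h3
  refine ⟨τ, fun i => ?_⟩
  have := hτ i
  split_ifs with hi
  · simpa [hi] using this
  · have h5 : a (τ i) ≠ 1 := by simpa [hi] using this
    exact (h1 _).resolve_left h5

/-- Diagonal matrices as a homomorphism. -/
noncomputable def diagHom (F : Type*) [Field F] :
    (Fin 4 → Fˣ) →* (Matrix (Fin 4) (Fin 4) F)ˣ :=
  MonoidHom.toHomUnits
    { toFun := fun d => Matrix.diagonal (fun i => (d i : F))
      map_one' := by simp
      map_mul' := by intro d e; simp [Matrix.diagonal_mul_diagonal] }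

lemma diagHom_apply (d : Fin 4 → Fˣ) (i j : Fin 4) :
    (diagHom F d).val i j = if i = j then (d i : F) else 0 := by
  simp [diagHom, Matrix.diagonal_apply]

/-- Permutation matrices as a homomorphism. -/
noncomputable def permHom (F : Type*) [Field F] :
    Equiv.Perm (Fin 4) →* (Matrix (Fin 4) (Fin 4) F)ˣ :=
  MonoidHom.toHomUnits
    { toFun := fun σ => Matrix.of (fun i j => if σ⁻¹ i = j then 1 else 0)
      map_one' := by ext i j; simp [Matrix.one_apply]
      map_mul' := by
        intro σ τ; ext i j
        rw [Matrix.mul_apply, Finset.sum_eq_single (σ⁻¹ i)]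
        · simp
        · intro b _ hb
          simp only [Matrix.of_apply]
          rw [if_neg (fun h => hb h.symm), zero_mul]
        · simp }

lemma permHom_apply (σ : Equiv.Perm (Fin 4)) (i j : Fin 4) :
    (permHom F σ).val i j = if σ⁻¹ i = j then (1 : F) else 0 := by
  simp [permHom]

lemma diag_perm_apply (d : Fin 4 → Fˣ) (σ : Equiv.Perm (Fin 4)) (i j : Fin 4) :
    (diagHom F d * permHom F σ).val i j = if σ⁻¹ i = j then (d i : F) else 0 := by
  rw [Units.val_mul, Matrix.mul_apply, Finset.sum_eq_single i]
  · simp [diagHom_apply, permHom_apply]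
  · intro b _ hb
    rw [diagHom_apply, if_neg (fun h => hb h.symm), zero_mul]
  · simp

lemma perm_mul_diag (d : Fin 4 → Fˣ) (σ : Equiv.Perm (Fin 4)) :
    permHom F σ * diagHom F d = diagHom F (fun i => d (σ⁻¹ i)) * permHom F σ := by
  ext i j
  rw [diag_perm_apply, Units.val_mul, Matrix.mul_apply]
  simp only [diagHom_apply, permHom_apply, mul_ite, ite_mul, one_mul, zero_mul, mul_zero,
    Finset.sum_ite_eq', Finset.mem_univ, if_true]
  split_ifs with h
  · rw [h]
  · rfl

lemma mk_eq_iff (a b : (Matrix (Fin 4) (Fin 4) F)ˣ) :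
    (QuotientGroup.mk a : PGL4 F) = QuotientGroup.mk b ↔ ∃ c : F, b.val = c • a.val := by
  rw [QuotientGroup.eq]
  constructor
  · rintro ⟨c, hc⟩
    refine ⟨c, ?_⟩
    have : b.val = a.val * (a⁻¹ * b).val := by
      rw [← Units.val_mul, mul_inv_cancel_left]
    rw [this, hc]; simp
  · rintro ⟨c, hc⟩
    refine ⟨c, ?_⟩
    rw [Units.val_mul, hc]; simp

lemma diag_mem (d : Fin 4 → Fˣ) (hd : ∀ i, d i ^ 3 = 1) :
    (QuotientGroup.mk (diagHom F d) : PGL4 F) ∈ autFermat F := by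
  have key : ∀ d : Fin 4 → Fˣ, (∀ i, d i ^ 3 = 1) →
      IsMon (diagHom F d).val 1 (fun i => (d i : F)) 1 := by
    intro d hd
    refine ⟨one_ne_zero, fun i => ?_, fun i j => ?_⟩
    · rw [← Units.val_pow_eq_pow_val, hd]; rfl
    · rw [diagHom_apply]; rfl
  refine ⟨_, rfl, preserves_of_le _ (key d hd).mem_cone ?_⟩
  rw [← map_inv]
  exact (key d⁻¹ (by intro i; simp [hd])).mem_cone

lemma perm_mem (σ : Equiv.Perm (Fin 4)) :
    (QuotientGroup.mk (permHom F σ) : PGL4 F) ∈ autFermat F := by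
  have key : ∀ σ : Equiv.Perm (Fin 4), IsMon (permHom F σ).val σ⁻¹ (fun i => 1) 1 :=
    fun σ => ⟨one_ne_zero, fun i => one_pow 3, fun i j => permHom_apply σ i j⟩
  refine ⟨_, rfl, preserves_of_le _ (key σ).mem_cone ?_⟩
  rw [← map_inv]
  exact (key σ⁻¹).mem_cone

/-- Inversion action of `ℤ/2` on `ℤ/3`. -/
def sgnAct : Multiplicative (ZMod 2) →* MulAut (Multiplicative (ZMod 3)) where
  toFun a := if a = 1 then 1 else MulEquiv.inv _
  map_one' := rfl
  map_mul' := by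
    intro a b
    ext x
    revert a b x
    decide

/-- The action of `(ℤ/2)²` on `(ℤ/3)³`. -/
def phiAct : (Multiplicative (ZMod 2) × Multiplicative (ZMod 2)) →*
    MulAut (Multiplicative (ZMod 3) × Multiplicative (ZMod 3) × Multiplicative (ZMod 3)) where
  toFun g := MulEquiv.prodCongr (sgnAct g.1) (MulEquiv.prodCongr (sgnAct g.2) (MulEquiv.refl _))
  map_one' := by
    ext x
    · change sgnAct 1 x.1 = x.1
      simp
    · change sgnAct 1 x.2.1 = x.2.1
      simp
    · rfl
  map_mul' := by
    intro a b
    ext x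
    · change sgnAct (a.1 * b.1) x.1 = sgnAct a.1 (sgnAct b.1 x.1)
      simp
    · change sgnAct (a.2 * b.2) x.2.1 = sgnAct a.2 (sgnAct b.2 x.2.1)
      simp
    · rfl

lemma phiAct_apply (a b x y z) :
    phiAct (a, b) (x, y, z) = (sgnAct a x, sgnAct b y, z) := rfl

/-- The permutations `⟨(01), (23)⟩`. -/
def rho : (Multiplicative (ZMod 2) × Multiplicative (ZMod 2)) →* Equiv.Perm (Fin 4) where
  toFun g := (if g.1 = 1 then 1 else Equiv.swap 0 1) * (if g.2 = 1 then 1 else Equiv.swap 2 3)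
  map_one' := by decide
  map_mul' := by decide

lemma rho_inj : Function.Injective rho := by decide

lemma rho_surj : ∀ σ : Equiv.Perm (Fin 4), (∀ i, (σ i).val < 2 ↔ i.val < 2) → ∃ g, rho g = σ := by
  decide

lemma rho_lt : ∀ g i, ((rho g)⁻¹ i).val < 2 ↔ i.val < 2 := by decide

lemma exists_chi (u : Fˣ) (h3 : u ^ 3 = 1) (h1 : u ≠ 1) :
    ∃ χ : Multiplicative (ZMod 3) →* Fˣ, Function.Injective χ ∧ ∀ x : Fˣ, x ^ 3 = 1 → ∃ n, χ n = x := by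
  have hp : IsPrimitiveRoot u 3 := by
    have : Fact (Nat.Prime 3) := ⟨Nat.prime_three⟩
    rw [← orderOf_eq_prime h3 h1]
    exact IsPrimitiveRoot.orderOf u
  have e : Multiplicative (ZMod 3) ≃* Subgroup.zpowers u := hp.zmodEquivZPowers.toMultiplicativeLeft
  refine ⟨(Subgroup.zpowers u).subtype.comp e.toMonoidHom, ?_, ?_⟩
  · exact Subtype.val_injective.comp e.injective
  · intro x hx
    have : x ∈ Subgroup.zpowers u := by
      rw [hp.zpowers_eq, mem_rootsOfUnity]; exact hx
    exact ⟨e.symm ⟨x, this⟩, by simp⟩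

/-- Embedding of `(ℤ/3)³` in the diagonal torus. -/
def nuHom (χ : Multiplicative (ZMod 3) →* Fˣ) :
    (Multiplicative (ZMod 3) × Multiplicative (ZMod 3) × Multiplicative (ZMod 3)) →*
      (Fin 4 → Fˣ) where
  toFun n := ![χ n.1, (χ n.1)⁻¹, χ n.2.1 * χ n.2.2, (χ n.2.1)⁻¹ * χ n.2.2]
  map_one' := by
    funext i; fin_cases i <;> simp
  map_mul' := by
    intro a b
    funext i; fin_cases i <;> simp [mul_comm, mul_left_comm, mul_assoc]

lemma nu_phi (χ : Multiplicative (ZMod 3) →* Fˣ) (g n) (i : Fin 4) :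
    nuHom χ (phiAct g n) i = nuHom χ n ((rho g)⁻¹ i) := by
  obtain ⟨a, b⟩ := g
  obtain ⟨x, y, z⟩ := n
  have ha : a = 1 ∨ a = Multiplicative.ofAdd 1 := by revert a; decide
  have hb : b = 1 ∨ b = Multiplicative.ofAdd 1 := by revert b; decide
  have s1 : sgnAct (Multiplicative.ofAdd 1) = MulEquiv.inv _ := rfl
  have r00 : (rho (1, 1))⁻¹ = 1 := by decide
  have r10 : (rho (Multiplicative.ofAdd 1, 1))⁻¹ = Equiv.swap 0 1 := by decide
  have r01 : (rho (1, Multiplicative.ofAdd 1))⁻¹ = Equiv.swap 2 3 := by decide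
  have r11 : (rho (Multiplicative.ofAdd 1, Multiplicative.ofAdd 1))⁻¹ =
    Equiv.swap 0 1 * Equiv.swap 2 3 := by decide
  rcases ha with rfl | rfl <;> rcases hb with rfl | rfl
  · rw [r00]
    fin_cases i <;> simp [nuHom, phiAct_apply]
  · rw [r01]
    fin_cases i <;> simp [nuHom, phiAct_apply, s1, Equiv.swap_apply_def]
  · rw [r10]
    fin_cases i <;> simp [nuHom, phiAct_apply, s1, Equiv.swap_apply_def]
  · rw [r11]
    fin_cases i <;> simp [nuHom, phiAct_apply, s1, Equiv.swap_apply_def]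

/-- The homomorphism from the semidirect product to `PGL₄`. -/
noncomputable def PhiHom (χ : Multiplicative (ZMod 3) →* Fˣ) :
    SemidirectProduct (Multiplicative (ZMod 3) × Multiplicative (ZMod 3) × Multiplicative (ZMod 3))
      (Multiplicative (ZMod 2) × Multiplicative (ZMod 2)) phiAct →* PGL4 F :=
  SemidirectProduct.lift
    (((QuotientGroup.mk' (scalarUnits F)).comp (diagHom F)).comp (nuHom χ))
    (((QuotientGroup.mk' (scalarUnits F)).comp (permHom F)).comp rho)
    (by
      intro g
      ext1 n
      simp only [MonoidHom.comp_apply, MulEquiv.coe_toMonoidHom, MulAut.conj_apply]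
      rw [← map_mul, ← map_inv, ← map_mul, perm_mul_diag, mul_inv_cancel_right]
      congr 2
      funext i
      exact nu_phi χ g n i)

lemma PhiHom_apply (χ : Multiplicative (ZMod 3) →* Fˣ) (x) :
    PhiHom χ x = QuotientGroup.mk (diagHom F (nuHom χ x.left) * permHom F (rho x.right)) := rfl

lemma chi_cube (χ : Multiplicative (ZMod 3) →* Fˣ) (n) : χ n ^ 3 = 1 := by
  have : n ^ 3 = 1 := by revert n; decide
  rw [← map_pow, this, map_one]

lemma nu_cube (χ : Multiplicative (ZMod 3) →* Fˣ) (n i) : nuHom χ n i ^ 3 = 1 := by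
  fin_cases i <;> simp [nuHom, mul_pow, chi_cube]

lemma PhiHom_injective (χ : Multiplicative (ZMod 3) →* Fˣ) (hχ : Function.Injective χ) :
    Function.Injective (PhiHom χ) := by
  rw [injective_iff_map_eq_one]
  intro x hx
  rw [PhiHom_apply, ← QuotientGroup.mk_one, eq_comm, mk_eq_iff] at hx
  obtain ⟨c, hc⟩ := hx
  have hent : ∀ i j, (if (rho x.right)⁻¹ i = j then (nuHom χ x.left i : F) else 0)
      = if i = j then c else 0 := by
    intro i j
    rw [← diag_perm_apply, hc]
    simp [Matrix.one_apply]
  have hr : rho x.right = 1 := by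
    rw [← inv_eq_one]
    ext1 i
    by_contra hne
    have := hent i ((rho x.right)⁻¹ i)
    rw [if_pos rfl, if_neg (fun h => hne h.symm)] at this
    exact Units.ne_zero _ this
  have hright : x.right = 1 := rho_inj (by rw [hr, map_one])
  have hd : ∀ i, (nuHom χ x.left i : F) = c := by
    intro i
    have := hent i i
    simpa [hr] using this
  have hd' : ∀ i j, nuHom χ x.left i = nuHom χ x.left j := fun i j =>
    Units.ext ((hd i).trans (hd j).symm)
  have sq : ∀ y : Fˣ, y ^ 3 = 1 → y = y⁻¹ → y = 1 := by
    intro y h3 h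
    have h2 : y ^ 2 = 1 := by rw [pow_two]; nth_rewrite 2 [h]; simp
    rw [pow_succ, h2, one_mul] at h3
    exact h3
  have e1 : χ x.left.1 = 1 := sq _ (chi_cube _ _) (by simpa [nuHom] using hd' 0 1)
  have e2 : χ x.left.2.1 = 1 := sq _ (chi_cube _ _) (by simpa [nuHom] using hd' 2 3)
  have e3 : χ x.left.2.2 = 1 := by
    have := hd' 0 2
    simp [nuHom, e1, e2] at this
    simpa using this.symm
  have f : ∀ n, χ n = 1 → n = 1 := fun n hn => hχ (by rw [hn, map_one])
  ext1
  · exact Prod.ext (f _ e1) (Prod.ext (f _ e2) (f _ e3))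
  · exact hright

/-- The diagonal vector `(1,1,u,u)`. -/
def dvec (u : Fˣ) : Fin 4 → Fˣ := fun i => if i.val < 2 then 1 else u

lemma isMon_of_mem [IsAlgClosed F]
    (hchar2 : (2 : F) ≠ 0) (hchar3 : (3 : F) ≠ 0)
    (ω : F) (hω3 : ω ^ 3 = 1) (hω : ω ≠ 1) (g : (Matrix (Fin 4) (Fin 4) F)ˣ)
    (h : (QuotientGroup.mk g : PGL4 F) ∈ autFermat F) : ∃ σ a k, IsMon g.val σ a k := by
  obtain ⟨g', hg', hp⟩ := h
  obtain ⟨c, hc⟩ := (mk_eq_iff _ _).1 hg'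
  apply exists_isMon hchar2 hchar3 ω hω3 hω
  intro v hv
  have h1 : g'.val.mulVec v ∈ fermatCone F := by
    rw [← hp]; exact ⟨v, hv, rfl⟩
  rw [hc, Matrix.smul_mulVec]
  rw [mem_cone_iff] at *
  simp only [Pi.smul_apply, smul_eq_mul, mul_pow, ← Finset.mul_sum, h1, mul_zero]

lemma PhiHom_range [IsAlgClosed F]
    (hchar2 : (2 : F) ≠ 0) (hchar3 : (3 : F) ≠ 0) (u : Fˣ) (h3 : u ^ 3 = 1) (h1 : u ≠ 1)
    (χ : Multiplicative (ZMod 3) →* Fˣ) (hχ : ∀ x : Fˣ, x ^ 3 = 1 → ∃ n, χ n = x) :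
    (PhiHom χ).range = autFermat F ⊓ Subgroup.centralizer {QuotientGroup.mk (diagHom F (dvec u))} := by
  apply le_antisymm
  · rintro _ ⟨x, rfl⟩
    rw [PhiHom_apply]
    refine ⟨?_, ?_⟩
    · rw [QuotientGroup.mk_mul]
      exact mul_mem (diag_mem _ (nu_cube χ _)) (perm_mem _)
    · change _ ∈ Subgroup.centralizer _
      rw [Subgroup.mem_centralizer_singleton_iff,
        ← QuotientGroup.mk_mul, ← QuotientGroup.mk_mul]
      congr 1
      have hd : (fun i => dvec u ((rho x.right)⁻¹ i)) = dvec u := by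
        funext i
        simp only [dvec, rho_lt]
      rw [mul_assoc, perm_mul_diag, hd, ← mul_assoc, ← mul_assoc, ← map_mul, ← map_mul, mul_comm]
  · rintro x ⟨hx, hc⟩
    induction x using QuotientGroup.induction_on with | H g => ?_
    have hω3 : (u : F) ^ 3 = 1 := by rw [← Units.val_pow_eq_pow_val, h3]; rfl
    have hω : (u : F) ≠ 1 := by simpa using h1
    obtain ⟨σ, a, k, hk, ha, hg⟩ := isMon_of_mem hchar2 hchar3 (u : F) hω3 hω g hx
    have ha0 : ∀ i, a i ≠ 0 := by
      intro i hi
      apply hk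
      rw [← ha i, hi]; ring
    change _ ∈ Subgroup.centralizer _ at hc
    rw [Subgroup.mem_centralizer_singleton_iff,
        ← QuotientGroup.mk_mul, ← QuotientGroup.mk_mul, mk_eq_iff] at hc
    obtain ⟨c, hc⟩ := hc
    have hc' : ∀ i, (dvec u i : F) = c * dvec u (σ i) := by
      intro i
      have := congrFun (congrFun hc i) (σ i)
      rw [Units.val_mul, Matrix.mul_apply, Finset.sum_eq_single i
        (fun b _ hb => by rw [diagHom_apply, if_neg (fun h => hb h.symm), zero_mul])
        (by simp), Matrix.smul_apply, Units.val_mul, Matrix.mul_apply,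
        Finset.sum_eq_single (σ i)
        (fun b _ hb => by rw [diagHom_apply, if_neg hb, mul_zero])
        (by simp), diagHom_apply, diagHom_apply, hg, if_pos rfl, if_pos rfl, if_pos rfl,
        smul_eq_mul] at this
      apply mul_right_cancel₀ (ha0 i)
      linear_combination this
    have hu2 : (u : F) ^ 2 ≠ 1 := by
      intro h'
      apply hω
      linear_combination hω3 - (u : F) * h'
    have hdv : ∀ i, (dvec u i : F) = 1 ∨ (dvec u i : F) = u := by
      intro i
      unfold dvec
      split_ifs <;> simp
    have d0 : (dvec u 0 : F) = 1 := by simp [dvec]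
    have d2 : (dvec u 2 : F) = u := by simp [dvec]
    have hc1 : c = 1 := by
      have e0 := hc' 0
      have e2 := hc' 2
      rw [d0] at e0
      rw [d2] at e2
      rcases hdv (σ 0) with h | h
      · rw [h, mul_one] at e0; exact e0.symm
      · rw [h] at e0
        rcases hdv (σ 2) with h' | h'
        · rw [h', mul_one] at e2
          exact absurd (by rw [pow_two]; nth_rewrite 1 [e2]; exact e0.symm) hu2
        · rw [h', ← e0] at e2
          exact absurd e2 hω
    have hlt : ∀ i, (σ i).val < 2 ↔ i.val < 2 := by
      intro i
      have e := hc' i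
      rw [hc1, one_mul, Units.val_inj] at e
      unfold dvec at e
      by_cases p : i.val < 2 <;> by_cases q : (σ i).val < 2 <;> simp [p, q, h1, h1.symm] at e ⊢
    obtain ⟨r, hr⟩ := rho_surj σ⁻¹ (fun i => by
      have := hlt (σ⁻¹ i)
      rw [show σ (σ⁻¹ i) = i from σ.apply_symm_apply i] at this
      exact this.symm)
    have hcc : k⁻¹ * a 0 * a 1 ≠ 0 := mul_ne_zero (mul_ne_zero (inv_ne_zero hk) (ha0 0)) (ha0 1)
    set cc := k⁻¹ * a 0 * a 1 with hccdef
    have hcc3 : cc ^ 3 * k = 1 := by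
      rw [hccdef]
      simp only [mul_pow, ha]
      field_simp
    let b : Fin 4 → Fˣ := fun i => Units.mk0 (cc * a i) (mul_ne_zero hcc (ha0 i))
    have hbv : ∀ i, (b i : F) = cc * a i := fun i => rfl
    have hb3 : ∀ i, b i ^ 3 = 1 := by
      intro i
      ext
      rw [Units.val_pow_eq_pow_val, hbv, mul_pow, ha, hcc3]; rfl
    have hb01 : b 0 * b 1 = 1 := by
      ext
      rw [Units.val_mul, hbv, hbv]
      have h01 : a 0 * a 1 = cc * k := by rw [hccdef]; field_simp
      rw [Units.val_one, ← hcc3]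
      linear_combination cc ^ 2 * h01
    obtain ⟨x, hx⟩ := hχ (b 0) (hb3 0)
    obtain ⟨y, hy⟩ := hχ (b 2 ^ 2 * b 3) (by
      rw [mul_pow, hb3, ← pow_mul, mul_comm 2 3, pow_mul, hb3]; simp)
    obtain ⟨z, hz⟩ := hχ ((b 2 * b 3) ^ 2) (by
      rw [← pow_mul, mul_comm 2 3, pow_mul, mul_pow, hb3, hb3]; simp)
    have hnu : ∀ i, nuHom χ (x, y, z) i = b i := by
      intro i
      have n0 : nuHom χ (x, y, z) 0 = b 0 := hx
      have n1 : nuHom χ (x, y, z) 1 = b 1 := by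
        change (χ x)⁻¹ = b 1
        rw [hx]; exact inv_eq_of_mul_eq_one_right hb01
      have n2 : nuHom χ (x, y, z) 2 = b 2 := by
        change χ y * χ z = b 2
        rw [hy, hz]
        calc b 2 ^ 2 * b 3 * (b 2 * b 3) ^ 2 = b 2 ^ 3 * b 3 ^ 3 * b 2 := by
              simp only [pow_succ, pow_zero, one_mul]; ac_rfl
          _ = b 2 := by rw [hb3, hb3]; simp
      have n3 : nuHom χ (x, y, z) 3 = b 3 := by
        change (χ y)⁻¹ * χ z = b 3
        rw [hy, hz, inv_mul_eq_iff_eq_mul]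
        simp only [pow_succ, pow_zero, one_mul]; ac_rfl
      fin_cases i
      · exact n0
      · exact n1
      · exact n2
      · exact n3
    refine ⟨⟨(x, y, z), r⟩, ?_⟩
    rw [PhiHom_apply, mk_eq_iff]
    refine ⟨cc⁻¹, ?_⟩
    ext i j
    rw [Matrix.smul_apply, diag_perm_apply, hg, hr, inv_inv, hnu, hbv]
    split_ifs
    · rw [smul_eq_mul, inv_mul_cancel_left₀ hcc]
    · simp

lemma exists_conj [IsAlgClosed F]
    (hchar2 : (2 : F) ≠ 0) (hchar3 : (3 : F) ≠ 0) (u : Fˣ) (h3 : u ^ 3 = 1) (h1 : u ≠ 1)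
    (g : (Matrix (Fin 4) (Fin 4) F)ˣ) (hs : (QuotientGroup.mk g : PGL4 F) ∈ autFermat F)
    (hg : g.val.charpoly = (X - 1) ^ 2 * (X - C (u : F)) ^ 2) :
    ∃ q ∈ autFermat F, (QuotientGroup.mk g : PGL4 F) =
      q * QuotientGroup.mk (diagHom F (dvec u)) * q⁻¹ := by
  have hω3 : (u : F) ^ 3 = 1 := by rw [← Units.val_pow_eq_pow_val, h3]; rfl
  have hω : (u : F) ≠ 1 := by simpa using h1
  obtain ⟨σ, a, k, hm⟩ := isMon_of_mem hchar2 hchar3 (u : F) hω3 hω g hs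
  obtain rfl := hm.perm_eq_one hchar2 (u : F) hω3 hω hg
  have hd : g.val = Matrix.diagonal a := by
    ext i j
    rw [hm.2.2, Matrix.diagonal_apply]; rfl
  rw [hd, Matrix.charpoly_diagonal] at hg
  obtain ⟨τ, hτ⟩ := exists_reorder (u : F) hω a hg
  refine ⟨QuotientGroup.mk (permHom F τ), perm_mem τ, ?_⟩
  rw [← QuotientGroup.mk_mul, ← QuotientGroup.mk_inv, ← QuotientGroup.mk_mul, perm_mul_diag,
    mul_inv_cancel_right]
  congr 1
  ext i j
  rw [diagHom_apply, hd, Matrix.diagonal_apply]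
  have := hτ (τ⁻¹ i)
  rw [show τ (τ⁻¹ i) = i from τ.apply_symm_apply i] at this
  rw [this]
  simp only [dvec]
  split_ifs <;> rfl

lemma main_aux [IsAlgClosed F]
    (hchar2 : (2 : F) ≠ 0) (hchar3 : (3 : F) ≠ 0) (ω : F) (hω3 : ω ^ 3 = 1) (hω : ω ≠ 1)
    (g : (Matrix (Fin 4) (Fin 4) F)ˣ) (hs : (QuotientGroup.mk g : PGL4 F) ∈ autFermat F)
    (hg : g.val.charpoly = (X - 1) ^ 2 * (X - C ω) ^ 2) :
    Nonempty ((↥(autFermat F ⊓ Subgroup.centralizer {(QuotientGroup.mk g : PGL4 F)})) ≃*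
        SemidirectProduct
          (Multiplicative (ZMod 3) × Multiplicative (ZMod 3) × Multiplicative (ZMod 3))
          (Multiplicative (ZMod 2) × Multiplicative (ZMod 2)) phiAct) := by
  have hω0 : ω ≠ 0 := by rintro rfl; simp at hω3
  obtain ⟨u, rfl⟩ : ∃ u : Fˣ, (u : F) = ω := ⟨Units.mk0 ω hω0, rfl⟩
  have h3 : u ^ 3 = 1 := by ext; simpa using hω3
  have h1 : u ≠ 1 := by simpa using hω
  obtain ⟨q, hq, hconj⟩ := exists_conj hchar2 hchar3 u h3 h1 g hs hg
  obtain ⟨χ, hχi, hχs⟩ := exists_chi u h3 h1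
  have hr := PhiHom_range hchar2 hchar3 u h3 h1 χ hχs
  rw [hconj]
  generalize (QuotientGroup.mk (diagHom F (dvec u)) : PGL4 F) = t at hr
  have hmap : (autFermat F ⊓ Subgroup.centralizer {t}).map (MulAut.conj q).toMonoidHom
      = autFermat F ⊓ Subgroup.centralizer {q * t * q⁻¹} := by
    ext x
    constructor
    · rintro ⟨y, ⟨hy1, hy2⟩, rfl⟩
      change _ ∈ Subgroup.centralizer _ at hy2
      rw [Subgroup.mem_centralizer_singleton_iff] at hy2
      refine ⟨(autFermat F).mul_mem ((autFermat F).mul_mem hq hy1) ((autFermat F).inv_mem hq), ?_⟩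
      change _ ∈ Subgroup.centralizer _
      rw [Subgroup.mem_centralizer_singleton_iff]
      change q * y * q⁻¹ * (q * t * q⁻¹) = q * t * q⁻¹ * (q * y * q⁻¹)
      calc q * y * q⁻¹ * (q * t * q⁻¹) = q * (y * t) * q⁻¹ := by group
        _ = _ := by rw [hy2]; group
    · rintro ⟨hy1, hy2⟩
      change _ ∈ Subgroup.centralizer _ at hy2
      rw [Subgroup.mem_centralizer_singleton_iff] at hy2
      refine ⟨q⁻¹ * x * q, ⟨(autFermat F).mul_mem ((autFermat F).mul_mem ((autFermat F).inv_mem hq) hy1) hq, ?_⟩, ?_⟩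
      · change _ ∈ Subgroup.centralizer _
        rw [Subgroup.mem_centralizer_singleton_iff]
        calc q⁻¹ * x * q * t = q⁻¹ * (x * (q * t * q⁻¹)) * q := by group
          _ = _ := by rw [hy2]; group
      · change q * (q⁻¹ * x * q) * q⁻¹ = x
        group
  rw [← hmap, ← hr]
  exact ⟨((MonoidHom.ofInjective (PhiHom_injective χ hχi)).trans
    ((MulAut.conj q).subgroupMap _)).symm⟩

end helpers

/-- Let `F` be an algebraically closed field of characteristic different from `2` and `3`,
with a primitive cube root of unity `ω`. For every element `s` of the automorphism group of
the Fermat cubic surface of type `A₂`, the centralizer of `s` in `Aut(S)` is isomorphic to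
a semidirect product `(ℤ/3ℤ)³ ⋊ (ℤ/2ℤ)²`; in particular it has order `108`. -/
theorem stmt_15 (F : Type*) [Field F] [IsAlgClosed F]
    (hchar2 : (2 : F) ≠ 0) (hchar3 : (3 : F) ≠ 0)
    (ω : F) (hω3 : ω ^ 3 = 1) (hω : ω ≠ 1)
    (s : PGL4 F) (hs : s ∈ autFermat F) (hsA2 : TypeA2 ω s) :
    (∃ φ : (Multiplicative (ZMod 2) × Multiplicative (ZMod 2)) →* MulAut (Multiplicative (ZMod 3) × Multiplicative (ZMod 3) × Multiplicative (ZMod 3)),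
      Nonempty ((↥(autFermat F ⊓ Subgroup.centralizer {s})) ≃*
        SemidirectProduct (Multiplicative (ZMod 3) × Multiplicative (ZMod 3) × Multiplicative (ZMod 3)) (Multiplicative (ZMod 2) × Multiplicative (ZMod 2)) φ)) ∧
    Nat.card ↥(autFermat F ⊓ Subgroup.centralizer {s}) = 108 := by
  obtain ⟨g, rfl, hg⟩ := hsA2
  have key : Nonempty ((↥(autFermat F ⊓ Subgroup.centralizer {(QuotientGroup.mk g : PGL4 F)})) ≃*
        SemidirectProduct
          (Multiplicative (ZMod 3) × Multiplicative (ZMod 3) × Multiplicative (ZMod 3))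
          (Multiplicative (ZMod 2) × Multiplicative (ZMod 2)) phiAct) := by
    rcases hg with hg | hg
    · exact main_aux hchar2 hchar3 ω hω3 hω g hs hg
    · refine main_aux hchar2 hchar3 (ω ^ 2) ?_ ?_ g hs hg
      · linear_combination (ω ^ 3 + 1) * hω3
      · intro h'
        apply hω
        linear_combination hω3 - ω * h'
  refine ⟨⟨phiAct, key⟩, ?_⟩
  obtain ⟨e⟩ := key
  rw [Nat.card_congr e.toEquiv, SemidirectProduct.card]
  simp
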